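/- arXiv:2402.00792 — 2 statements merged into one kernel-verified Lean document; each statement's English description precedes it below -/
import Mathlib

section
/- Let A be a unital Banach algebra, let (c_n)_{n≥0} be complex coefficients, let δ > 0 be such that γ'(δ) := ∑_{n≥0} n|c_n|δ^{n−1} converges, and let N ≥ 1. Let d₁,…,d_N ∈ A with ‖d_k‖ ≤ δ for all k, set Δ_N = (1/N)∑_{k=1}^N d_k, and let O ∈ A. Suppose there is a subset S ⊆ {1,…,N} with |S| = N_O such that for every j ∉ S one has [d_j, O] = 0 and [d_j, d_k] = 0 for all k. Then, with Γ(Δ_N) = ∑_{n≥0} c_n Δ_N^n, the double commutator satisfies ‖[Γ(Δ_N), [Γ(Δ_N), O]]‖ ≤ (4 N_O² / N²) ‖O‖ δ² γ'(δ)². -/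
section PowerSeriesCommutator

variable {A : Type*} [NormedRing A]

/-- The Leibniz rule for the ring commutator. -/
theorem ring_leibniz_lie {R : Type*} [Ring R] (a b c : R) :
    ⁅a, ⁅b, c⁆⁆ = ⁅⁅a, b⁆, c⁆ + ⁅b, ⁅a, c⁆⁆ := by
  simp only [Ring.lie_def]
  noncomm_ring

/-- If `‖a‖ ≤ r`, the commutator with `a ^ n` is bounded by `n * r ^ (n - 1)` times the
commutator with `a`. -/
theorem norm_lie_pow_le [NormOneClass A] {a : A} {r : ℝ} (ha : ‖a‖ ≤ r) (b : A) (n : ℕ) :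
    ‖⁅a ^ n, b⁆‖ ≤ n * r ^ (n - 1) * ‖⁅a, b⁆‖ := by
  have hr : 0 ≤ r := (norm_nonneg a).trans ha
  induction n with
  | zero => simp [Ring.lie_def]
  | succ n ih =>
    have hsplit : ⁅a ^ (n + 1), b⁆ = a ^ n * ⁅a, b⁆ + ⁅a ^ n, b⁆ * a := by
      simp only [Ring.lie_def, pow_succ]
      noncomm_ring
    have hpow : ‖a ^ n‖ ≤ r ^ n :=
      (norm_pow_le a n).trans (pow_le_pow_left₀ (norm_nonneg a) ha n)
    have hstep : (n : ℝ) * r ^ (n - 1) * r = n * r ^ n := by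
      cases n with
      | zero => simp
      | succ m => simp [pow_succ, mul_assoc]
    calc ‖⁅a ^ (n + 1), b⁆‖ ≤ ‖a ^ n‖ * ‖⁅a, b⁆‖ + ‖⁅a ^ n, b⁆‖ * ‖a‖ := by
          rw [hsplit]
          exact (norm_add_le _ _).trans (add_le_add (norm_mul_le _ _) (norm_mul_le _ _))
      _ ≤ r ^ n * ‖⁅a, b⁆‖ + n * r ^ (n - 1) * ‖⁅a, b⁆‖ * r := by gcongr
      _ = (n * r ^ (n - 1) * r + r ^ n) * ‖⁅a, b⁆‖ := by ring
      _ = ((n + 1 : ℕ) : ℝ) * r ^ (n + 1 - 1) * ‖⁅a, b⁆‖ := by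
          rw [hstep, Nat.add_sub_cancel]
          push_cast
          ring

/-- A power series whose derivative converges absolutely at `r` is summable at every element
of norm at most `r`. -/
theorem summable_smul_pow_of_summable_deriv [NormOneClass A] [NormedAlgebra ℂ A]
    [CompleteSpace A] {c : ℕ → ℂ} {a : A} {r : ℝ} (ha : ‖a‖ ≤ r)
    (hc : Summable fun n : ℕ => (n : ℝ) * ‖c n‖ * r ^ (n - 1)) :
    Summable fun n : ℕ => c n • a ^ n := by
  have hr : 0 ≤ r := (norm_nonneg a).trans ha
  rw [← summable_nat_add_iff 1]
  refine Summable.of_norm_bounded (((summable_nat_add_iff 1).2 hc).mul_right r) fun n => ?_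
  rw [norm_smul]
  calc ‖c (n + 1)‖ * ‖a ^ (n + 1)‖ ≤ ‖c (n + 1)‖ * r ^ (n + 1) := by
        gcongr
        exact (norm_pow_le a _).trans (pow_le_pow_left₀ (norm_nonneg a) ha _)
    _ ≤ ((n + 1 : ℕ) : ℝ) * (‖c (n + 1)‖ * r ^ (n + 1)) :=
        le_mul_of_one_le_left (by positivity) (by simp)
    _ = ((n + 1 : ℕ) : ℝ) * ‖c (n + 1)‖ * r ^ (n + 1 - 1) * r := by
        rw [Nat.add_sub_cancel, pow_succ]
        ring

/-- The commutator with a power series in `a` is bounded by the derivative of its absolute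
value series times the commutator with `a`. -/
theorem norm_lie_tsum_smul_pow_le [NormOneClass A] [NormedAlgebra ℂ A] [CompleteSpace A]
    {c : ℕ → ℂ} {a : A} {r : ℝ} (ha : ‖a‖ ≤ r)
    (hc : Summable fun n : ℕ => (n : ℝ) * ‖c n‖ * r ^ (n - 1)) (b : A) :
    ‖⁅∑' n : ℕ, c n • a ^ n, b⁆‖ ≤
      (∑' n : ℕ, (n : ℝ) * ‖c n‖ * r ^ (n - 1)) * ‖⁅a, b⁆‖ := by
  have hs := (summable_smul_pow_of_summable_deriv ha hc).hasSum
  have hlie := (hs.mul_right b).sub (hs.mul_left b)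
  rw [Ring.lie_def (∑' n : ℕ, c n • a ^ n), ← hlie.tsum_eq]
  refine tsum_of_norm_bounded (hc.hasSum.mul_right ‖⁅a, b⁆‖) fun n => ?_
  rw [smul_mul_assoc, mul_smul_comm, ← smul_sub, ← Ring.lie_def, norm_smul]
  calc ‖c n‖ * ‖⁅a ^ n, b⁆‖ ≤ ‖c n‖ * (n * r ^ (n - 1) * ‖⁅a, b⁆‖) := by
        gcongr
        exact norm_lie_pow_le ha b n
    _ = n * ‖c n‖ * r ^ (n - 1) * ‖⁅a, b⁆‖ := by ring

/-- The double commutator with a power series in `a` is bounded by the square of the derivative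
of its absolute value series times the double commutator with `a`. -/
theorem norm_lie_lie_tsum_smul_pow_le [NormOneClass A] [NormedAlgebra ℂ A] [CompleteSpace A]
    {c : ℕ → ℂ} {a : A} {r : ℝ} (ha : ‖a‖ ≤ r)
    (hc : Summable fun n : ℕ => (n : ℝ) * ‖c n‖ * r ^ (n - 1)) (b : A) :
    ‖⁅∑' n : ℕ, c n • a ^ n, ⁅∑' n : ℕ, c n • a ^ n, b⁆⁆‖ ≤
      (∑' n : ℕ, (n : ℝ) * ‖c n‖ * r ^ (n - 1)) ^ 2 * ‖⁅a, ⁅a, b⁆⁆‖ := by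
  have hr : 0 ≤ r := (norm_nonneg a).trans ha
  have hcomm : ⁅a, ∑' n : ℕ, c n • a ^ n⁆ = 0 := by
    rw [← commute_iff_lie_eq]
    exact Commute.tsum_right _ fun n => ((Commute.refl a).pow_right n).smul_right (c n)
  have hswap : ⁅a, ⁅∑' n : ℕ, c n • a ^ n, b⁆⁆ = ⁅∑' n : ℕ, c n • a ^ n, ⁅a, b⁆⁆ := by
    rw [ring_leibniz_lie, hcomm]
    simp [Ring.lie_def]
  have hγ : 0 ≤ ∑' n : ℕ, (n : ℝ) * ‖c n‖ * r ^ (n - 1) :=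
    tsum_nonneg fun n => by positivity
  refine (norm_lie_tsum_smul_pow_le ha hc _).trans ?_
  rw [hswap, sq, mul_assoc]
  exact mul_le_mul_of_nonneg_left (norm_lie_tsum_smul_pow_le ha hc _) hγ

theorem norm_lie_le_two_mul (a b : A) : ‖⁅a, b⁆‖ ≤ 2 * ‖a‖ * ‖b‖ := by
  rw [Ring.lie_def]
  linarith [norm_sub_le (a * b) (b * a), norm_mul_le a b, norm_mul_le b a,
    mul_comm ‖a‖ ‖b‖]

/-- A summand commuting with both the other summand and `b` drops out of the double
commutator. -/
theorem lie_lie_add_of_lie_eq_zero {x y b : A} (hyx : ⁅y, x⁆ = 0) (hyb : ⁅y, b⁆ = 0) :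
    ⁅x + y, ⁅x + y, b⁆⁆ = ⁅x, ⁅x, b⁆⁆ := by
  have hinner : ⁅x + y, b⁆ = ⁅x, b⁆ := by
    rw [← add_zero ⁅x, b⁆, ← hyb]
    simp only [Ring.lie_def]
    noncomm_ring
  have houter : ⁅y, ⁅x, b⁆⁆ = 0 := by
    rw [ring_leibniz_lie, hyx, hyb]
    simp [Ring.lie_def]
  rw [hinner, ← add_zero ⁅x, ⁅x, b⁆⁆, ← houter]
  simp only [Ring.lie_def]
  noncomm_ring

end PowerSeriesCommutator

/-- The norm of a partial average of elements of norm at most `r`. -/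
theorem norm_inv_smul_sum_le {A : Type*} [NormedRing A] [NormedAlgebra ℂ A] {N : ℕ}
    {d : Fin N → A} {r : ℝ} (hd : ∀ k, ‖d k‖ ≤ r) (S : Finset (Fin N)) :
    ‖(N : ℂ)⁻¹ • ∑ k ∈ S, d k‖ ≤ (S.card : ℝ) / N * r := by
  rw [norm_smul, norm_inv, Complex.norm_natCast, div_eq_inv_mul, mul_assoc]
  gcongr
  simpa using norm_sum_le_of_le S fun k _ => hd k


/-- Bound on the double commutator of an operator-valued function `Γ(Δ_N)` of an
average operator with a strictly local operator `O` supported on `N_O` sites. -/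
theorem double_commutator_operator_valued_function_local_bound
    {A : Type*} [NormedRing A] [NormOneClass A] [NormedAlgebra ℂ A] [CompleteSpace A]
    (c : ℕ → ℂ) (δ : ℝ) (hδ : 0 < δ)
    (hγ' : Summable fun n : ℕ => (n : ℝ) * ‖c n‖ * δ ^ (n - 1))
    (N : ℕ) (hN : 1 ≤ N) (d : Fin N → A) (hd : ∀ k, ‖d k‖ ≤ δ)
    (O : A) (NO : ℕ) (S : Finset (Fin N)) (hScard : S.card = NO)
    (hcommO : ∀ j ∉ S, ⁅d j, O⁆ = 0)
    (hcommd : ∀ j ∉ S, ∀ k : Fin N, ⁅d j, d k⁆ = 0) :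
    ‖⁅∑' n : ℕ, c n • ((N : ℂ)⁻¹ • ∑ k, d k) ^ n,
        ⁅∑' n : ℕ, c n • ((N : ℂ)⁻¹ • ∑ k, d k) ^ n, O⁆⁆‖ ≤
      4 * NO ^ 2 / N ^ 2 * ‖O‖ *
        (δ ^ 2 * (∑' n : ℕ, (n : ℝ) * ‖c n‖ * δ ^ (n - 1)) ^ 2) := by
  have hN0 : (N : ℝ) ≠ 0 := by positivity
  have hΔ : ‖(N : ℂ)⁻¹ • ∑ k, d k‖ ≤ δ := by
    simpa [hN0] using norm_inv_smul_sum_le hd Finset.univ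
  have hsplit : (N : ℂ)⁻¹ • ∑ k, d k =
      (N : ℂ)⁻¹ • ∑ k ∈ S, d k + (N : ℂ)⁻¹ • ∑ k ∈ Sᶜ, d k := by
    rw [← smul_add, Finset.sum_add_sum_compl]
  have hout : ∀ b : A, (∀ j ∉ S, ⁅d j, b⁆ = 0) → ⁅(N : ℂ)⁻¹ • ∑ k ∈ Sᶜ, d k, b⁆ = 0 := by
    intro b hb
    rw [← commute_iff_lie_eq]
    exact (Commute.sum_left _ _ _ fun j hj =>
      commute_iff_lie_eq.2 (hb j (Finset.mem_compl.1 hj))).smul_left _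
  have hlocal : ⁅(N : ℂ)⁻¹ • ∑ k, d k, ⁅(N : ℂ)⁻¹ • ∑ k, d k, O⁆⁆ =
      ⁅(N : ℂ)⁻¹ • ∑ k ∈ S, d k, ⁅(N : ℂ)⁻¹ • ∑ k ∈ S, d k, O⁆⁆ := by
    rw [hsplit]
    refine lie_lie_add_of_lie_eq_zero (hout _ fun j hj => ?_) (hout O hcommO)
    rw [← commute_iff_lie_eq]
    exact (Commute.sum_right _ _ _ fun k _ =>
      commute_iff_lie_eq.2 (hcommd j hj k)).smul_right _
  have hX := norm_inv_smul_sum_le hd S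
  rw [hScard] at hX
  have hdouble : ‖⁅(N : ℂ)⁻¹ • ∑ k ∈ S, d k, ⁅(N : ℂ)⁻¹ • ∑ k ∈ S, d k, O⁆⁆‖ ≤
      2 * ((NO : ℝ) / N * δ) * (2 * ((NO : ℝ) / N * δ) * ‖O‖) := by
    refine (norm_lie_le_two_mul _ _).trans ?_
    gcongr
    refine (norm_lie_le_two_mul _ _).trans ?_
    gcongr
  refine (norm_lie_lie_tsum_smul_pow_le hΔ hγ' O).trans ?_
  rw [hlocal]
  refine (mul_le_mul_of_nonneg_left hdouble (sq_nonneg _)).trans_eq ?_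
  field_simp
  ring
end

section
/- Let A be a unital Banach algebra, let (c_n)_{n≥0} be complex coefficients, let δ > 0 be such that γ'(δ) := ∑_{n≥0} n|c_n|δ^{n−1} converges, let N ≥ 1, and let d₁,…,d_N ∈ A with ‖d_k‖ ≤ δ. Set Δ_N = (1/N)∑_{k=1}^N d_k. Let x₁,…,x_N ∈ A with ‖x_k‖ ≤ a for all k and [d_j, x_k] = 0 whenever j ≠ k, and set X_N = (1/N)∑_{k=1}^N x_k. Then, with Γ(Δ_N) = ∑_{n≥0} c_n Δ_N^n, one has ‖[Γ(Δ_N), X_N]‖ ≤ (2/N) a δ γ'(δ). -/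
/-- A commutator with an `n`-th power is at most `n r ^ (n - 1)` times the commutator with the
base, for a base of norm at most `r`. -/
theorem norm_pow_lie_le {A : Type*} [NormedRing A] [NormOneClass A] {u v : A} {r : ℝ}
    (hu : ‖u‖ ≤ r) (n : ℕ) : ‖⁅u ^ n, v⁆‖ ≤ n * r ^ (n - 1) * ‖⁅u, v⁆‖ := by
  have hr : 0 ≤ r := (norm_nonneg u).trans hu
  induction n with
  | zero => simp [Ring.lie_def]
  | succ n ih =>
    have h : ⁅u ^ (n + 1), v⁆ = u ^ n * ⁅u, v⁆ + ⁅u ^ n, v⁆ * u := by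
      simp only [Ring.lie_def, pow_succ]
      noncomm_ring
    have hpow : ‖u ^ n‖ ≤ r ^ n := (norm_pow_le u n).trans (by gcongr)
    have hn : (n : ℝ) * r ^ (n - 1) * r = n * r ^ n := by
      cases n with
      | zero => simp
      | succ m => simp [pow_succ, mul_assoc]
    calc ‖⁅u ^ (n + 1), v⁆‖ ≤ ‖u ^ n‖ * ‖⁅u, v⁆‖ + ‖⁅u ^ n, v⁆‖ * ‖u‖ := by
          rw [h]
          exact norm_add_le_of_le (norm_mul_le _ _) (norm_mul_le _ _)
      _ ≤ r ^ n * ‖⁅u, v⁆‖ + n * r ^ (n - 1) * ‖⁅u, v⁆‖ * r := by gcongr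
      _ = ((n + 1 : ℕ) : ℝ) * r ^ (n + 1 - 1) * ‖⁅u, v⁆‖ := by
          rw [mul_right_comm _ _ r, hn]
          push_cast
          ring

/-- An average of elements of norm at most `r` has norm at most `r`. -/
theorem norm_average_le {A : Type*} [NormedRing A] [NormedAlgebra ℂ A] {N : ℕ} (hN : 1 ≤ N)
    {d : Fin N → A} {r : ℝ} (hd : ∀ k, ‖d k‖ ≤ r) : ‖(N : ℂ)⁻¹ • ∑ k, d k‖ ≤ r := by
  have hN0 : (0 : ℝ) < N := by exact_mod_cast hN
  have hsum : ‖∑ k, d k‖ ≤ N * r := by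
    simpa using norm_sum_le_of_le Finset.univ fun k _ => hd k
  rw [norm_smul, norm_inv, Complex.norm_natCast, inv_mul_le_iff₀ hN0]
  exact hsum

/-- The commutator of two averages, of families that commute off the diagonal, is of order
`1 / N`. -/
theorem norm_lie_average_le {A : Type*} [NormedRing A] [NormedAlgebra ℂ A] {N : ℕ} (hN : 1 ≤ N)
    {d x : Fin N → A} {r a : ℝ} (hd : ∀ k, ‖d k‖ ≤ r) (hx : ∀ k, ‖x k‖ ≤ a)
    (hcomm : ∀ j k : Fin N, j ≠ k → ⁅d j, x k⁆ = 0) :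
    ‖⁅(N : ℂ)⁻¹ • ∑ k, d k, (N : ℂ)⁻¹ • ∑ k, x k⁆‖ ≤ 2 / N * (a * r) := by
  have hN0 : (0 : ℝ) < N := by exact_mod_cast hN
  have hdiag : ⁅∑ k, d k, ∑ k, x k⁆ = ∑ k, ⁅d k, x k⁆ := by
    have hexpand : ⁅∑ k, d k, ∑ k, x k⁆ = ∑ j, ∑ k, ⁅d j, x k⁆ := by
      simp only [Ring.lie_def, Finset.sum_sub_distrib, Finset.sum_mul_sum]
      rw [Finset.sum_comm (f := fun j k => x k * d j)]
    rw [hexpand]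
    refine Finset.sum_congr rfl fun j _ => ?_
    exact Finset.sum_eq_single j (fun k _ hkj => hcomm j k hkj.symm) (by simp)
  have hlie : ⁅(N : ℂ)⁻¹ • ∑ k, d k, (N : ℂ)⁻¹ • ∑ k, x k⁆ =
      (N : ℂ)⁻¹ • ((N : ℂ)⁻¹ • ∑ k, ⁅d k, x k⁆) := by
    rw [← hdiag]
    simp only [Ring.lie_def, smul_mul_assoc, mul_smul_comm, smul_sub]
  have hterm : ∀ k, ‖⁅d k, x k⁆‖ ≤ 2 * (a * r) := fun k => by
    have h₁ : ‖d k * x k‖ ≤ r * a := norm_mul_le_of_le (hd k) (hx k)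
    have h₂ : ‖x k * d k‖ ≤ a * r := norm_mul_le_of_le (hx k) (hd k)
    rw [Ring.lie_def]
    linarith [norm_sub_le (d k * x k) (x k * d k)]
  rw [hlie, norm_smul, norm_inv, Complex.norm_natCast, inv_mul_le_iff₀ hN0]
  refine (norm_average_le hN hterm).trans_eq ?_
  field_simp

/-- Bound on the commutator of an operator-valued function `Γ(Δ_N)` of an average
operator with another average operator `X_N`. -/
theorem commutator_operator_valued_function_average_bound
    {A : Type*} [NormedRing A] [NormOneClass A] [NormedAlgebra ℂ A] [CompleteSpace A]
    (c : ℕ → ℂ) (δ : ℝ) (hδ : 0 < δ)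
    (hγ' : Summable fun n : ℕ => (n : ℝ) * ‖c n‖ * δ ^ (n - 1))
    (N : ℕ) (hN : 1 ≤ N) (d : Fin N → A) (hd : ∀ k, ‖d k‖ ≤ δ)
    (x : Fin N → A) (a : ℝ) (hx : ∀ k, ‖x k‖ ≤ a)
    (hcomm : ∀ j k : Fin N, j ≠ k → ⁅d j, x k⁆ = 0) :
    ‖⁅∑' n : ℕ, c n • ((N : ℂ)⁻¹ • ∑ k, d k) ^ n, (N : ℂ)⁻¹ • ∑ k, x k⁆‖ ≤
      2 / N * (a * δ * ∑' n : ℕ, (n : ℝ) * ‖c n‖ * δ ^ (n - 1)) := by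
  have hD := norm_average_le hN hd
  have hDX := norm_lie_average_le hN hd hx hcomm
  set D : A := (N : ℂ)⁻¹ • ∑ k, d k
  set X : A := (N : ℂ)⁻¹ • ∑ k, x k
  have hsum : Summable fun n : ℕ => c n • D ^ n := by
    refine Summable.of_norm_bounded_eventually_nat (hγ'.mul_left δ) ?_
    filter_upwards [Filter.eventually_ge_atTop 1] with n hn
    have hn1 : (1 : ℝ) ≤ n := by exact_mod_cast hn
    calc ‖c n • D ^ n‖ ≤ ‖c n‖ * δ ^ n := by
          rw [norm_smul]
          gcongr
          exact (norm_pow_le D n).trans (by gcongr)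
      _ ≤ n * (‖c n‖ * δ ^ n) := le_mul_of_one_le_left (by positivity) hn1
      _ = δ * (n * ‖c n‖ * δ ^ (n - 1)) := by
          rw [← mul_pow_sub_one (by lia : n ≠ 0) δ]
          ring
  have hlie : ⁅∑' n : ℕ, c n • D ^ n, X⁆ = ∑' n : ℕ, ⁅c n • D ^ n, X⁆ := by
    simp only [Ring.lie_def]
    rw [(hsum.mul_right X).tsum_sub (hsum.mul_left X), hsum.tsum_mul_right, hsum.tsum_mul_left]
  rw [hlie, ← mul_assoc]
  refine tsum_of_norm_bounded (hγ'.hasSum.mul_left _) fun n => ?_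
  have hsmul : ⁅c n • D ^ n, X⁆ = c n • ⁅D ^ n, X⁆ := by
    simp only [Ring.lie_def, smul_mul_assoc, mul_smul_comm, smul_sub]
  calc ‖⁅c n • D ^ n, X⁆‖ ≤ ‖c n‖ * (n * δ ^ (n - 1) * ‖⁅D, X⁆‖) := by
        rw [hsmul, norm_smul]
        gcongr
        exact norm_pow_lie_le hD n
    _ ≤ ‖c n‖ * (n * δ ^ (n - 1) * (2 / N * (a * δ))) := by gcongr
    _ = 2 / N * (a * δ) * (n * ‖c n‖ * δ ^ (n - 1)) := by ring
end
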